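/- Let $h$ be a Griffiths semi-negative singular Hermitian metric on a trivial bundle over a polydisk with $\det h>\epsilon$ for some $\epsilon>0$. Then in the sense of distributions, $\partial\left(\frac{1}{\det h}\right) = -\frac{\partial\det h}{\det^2 h}$. -/

import Mathlib

open MeasureTheory Complex Metric Matrix Filter Topology
open scoped ComplexOrder ENNReal NNReal

noncomputable section

abbrev Cn (n : ℕ) := Fin n → ℂ

def basisV {n : ℕ} (j : Fin n) : Cn n := fun k => if k = j then 1 else 0

/-- Wirtinger derivative `∂/∂z_j` (junk value where `f` is not differentiable). -/
def wder {n : ℕ} (j : Fin n) (f : Cn n → ℂ) (z : Cn n) : ℂ :=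
  (1 / 2 : ℂ) * (fderiv ℝ f z (basisV j) - Complex.I * fderiv ℝ f z (Complex.I • basisV j))

/-- Wirtinger derivative `∂/∂z̄_j`. -/
def wbar {n : ℕ} (j : Fin n) (f : Cn n → ℂ) (z : Cn n) : ℂ :=
  (1 / 2 : ℂ) * (fderiv ℝ f z (basisV j) + Complex.I * fderiv ℝ f z (Complex.I • basisV j))

/-- Plurisubharmonicity (extended-real valued) on `U`: upper semicontinuity together with the
sub-mean value property on complex lines, expressed via comparison with boundary values of
harmonic functions (real parts of holomorphic functions) on discs. -/
def PshOn {n : ℕ} (f : Cn n → EReal) (U : Set (Cn n)) : Prop :=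
  UpperSemicontinuousOn f U ∧
  ∀ z ∈ U, ∀ v : Cn n, ∀ r : ℝ, 0 < r →
    (∀ w : ℂ, ‖w‖ ≤ r → z + w • v ∈ U) →
    ∀ F : ℂ → ℂ, ContinuousOn F (closedBall 0 r) → DifferentiableOn ℂ F (ball 0 r) →
      (∀ w : ℂ, ‖w‖ = r → f (z + w • v) ≤ ((F w).re : EReal)) →
      f z ≤ ((F 0).re : EReal)

def PshOnR {n : ℕ} (f : Cn n → ℝ) (U : Set (Cn n)) : Prop :=
  PshOn (fun z => (f z : EReal)) U

/-- `|v|²_h` for a Hermitian matrix `h`. -/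
def sqNorm {r : ℕ} (h : Matrix (Fin r) (Fin r) ℂ) (v : Fin r → ℂ) : ℝ :=
  (star v ⬝ᵥ h.mulVec v).re

/-- Chern connection form `θ_j = h⁻¹ ∂_j h`. -/
def connForm {n r : ℕ} (h : Cn n → Matrix (Fin r) (Fin r) ℂ) (j : Fin n) (z : Cn n) :
    Matrix (Fin r) (Fin r) ℂ :=
  (h z)⁻¹ * (Matrix.of fun a b => wder j (fun w => h w a b) z)

/-- Chern curvature coefficients `Θ_{j k̄} = ∂̄_k (h⁻¹ ∂_j h)`. -/
def curvMat {n r : ℕ} (h : Cn n → Matrix (Fin r) (Fin r) ℂ) (j k : Fin n) (z : Cn n) :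
    Matrix (Fin r) (Fin r) ℂ :=
  Matrix.of fun a b => wbar k (fun w => connForm h j w a b) z

/-- The Hermitian form `Θ_{E,h}(ξ ⊗ v, ξ ⊗ v) = (√-1 Θ(ξ, ξ̄) v, v)_h`. -/
def griffithsForm {n r : ℕ} (h : Cn n → Matrix (Fin r) (Fin r) ℂ) (z : Cn n)
    (ξ : Fin n → ℂ) (v : Fin r → ℂ) : ℝ :=
  - (∑ j, ∑ k, ξ j * (starRingEnd ℂ) (ξ k) *
      (star v ⬝ᵥ ((h z) * curvMat h j k z).mulVec v)).re

def SmoothMetricOn {n r : ℕ} (U : Set (Cn n)) (h : Cn n → Matrix (Fin r) (Fin r) ℂ) : Prop :=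
  (∀ a b, ContDiffOn ℝ (⊤ : ℕ∞) (fun z => h z a b) U) ∧ ∀ z ∈ U, (h z).PosDef

def HolSection {n r : ℕ} (V : Set (Cn n)) (u : Cn n → Fin r → ℂ) : Prop :=
  ∀ a, DifferentiableOn ℂ (fun z => u z a) V

/-- Griffiths semi-negativity: `|u|²_h` is psh for every local holomorphic section. -/
def GriffithsSemiNegOn {n r : ℕ} (U : Set (Cn n)) (h : Cn n → Matrix (Fin r) (Fin r) ℂ) : Prop :=
  ∀ V, IsOpen V → V ⊆ U → ∀ u, HolSection V u →
    PshOnR (fun z => sqNorm (h z) (u z)) V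

/-- The dual metric `h⋆` on the dual bundle. -/
def dualMetric {n r : ℕ} (h : Cn n → Matrix (Fin r) (Fin r) ℂ) (z : Cn n) :
    Matrix (Fin r) (Fin r) ℂ := ((h z)⁻¹)ᵀ

def GriffithsSemiPosOn {n r : ℕ} (U : Set (Cn n)) (h : Cn n → Matrix (Fin r) (Fin r) ℂ) : Prop :=
  GriffithsSemiNegOn U (dualMetric h)

def IsSingularMetricOn {n r : ℕ} (U : Set (Cn n)) (h : Cn n → Matrix (Fin r) (Fin r) ℂ) : Prop :=
  (∀ a b, Measurable fun z => h z a b) ∧ (∀ z ∈ U, (h z).PosSemidef) ∧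
    (∀ᵐ z, z ∈ U → (h z).det ≠ 0)

def Polydisk {n : ℕ} (R : Fin n → ℝ) : Set (Cn n) := {z | ∀ j, ‖z j‖ < R j}

/-- `F = ∂_m f` in the sense of distributions on `U`. -/
def IsWeakWirtDeriv {n : ℕ} (U : Set (Cn n)) (m : Fin n) (f F : Cn n → ℂ) : Prop :=
  ∀ φ : Cn n → ℂ, ContDiff ℝ (⊤ : ℕ∞) φ → HasCompactSupport φ → tsupport φ ⊆ U →
    ∫ z in U, f z * wder m φ z = - ∫ z in U, F z * φ z

def LocL2On {n : ℕ} (U : Set (Cn n)) (f : Cn n → ℂ) : Prop :=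
  ∀ K, IsCompact K → K ⊆ U → (∫⁻ z in K, (‖f z‖₊ : ℝ≥0∞) ^ 2) < ⊤

def LocL1On {n : ℕ} (U : Set (Cn n)) (f : Cn n → ℂ) : Prop :=
  ∀ K, IsCompact K → K ⊆ U → (∫⁻ z in K, (‖f z‖₊ : ℝ≥0∞)) < ⊤

open scoped Convolution

theorem continuous_wder {n : ℕ} (m : Fin n) {f : Cn n → ℂ} (hf : ContDiff ℝ 1 f) :
    Continuous (wder m f) := by
  have := hf.continuous_fderiv one_ne_zero
  unfold wder
  fun_prop

theorem wder_eq_zero_of_notMem_tsupport {n : ℕ} (m : Fin n) {f : Cn n → ℂ} {z : Cn n}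
    (hz : z ∉ tsupport f) : wder m f z = 0 := by
  simp [wder, fderiv_of_notMem_tsupport (𝕜 := ℝ) hz]

theorem hasCompactSupport_wder {n : ℕ} (m : Fin n) {f : Cn n → ℂ} (hf : HasCompactSupport f) :
    HasCompactSupport (wder m f) :=
  HasCompactSupport.intro hf fun _ hz => wder_eq_zero_of_notMem_tsupport m hz

theorem integrable_wder {n : ℕ} (m : Fin n) {f : Cn n → ℂ} (hf : ContDiff ℝ 1 f)
    (hc : HasCompactSupport f) : Integrable (wder m f) :=
  (continuous_wder m hf).integrable_of_hasCompactSupport (hasCompactSupport_wder m hc)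

theorem integral_fderiv_apply_eq_zero {n : ℕ} {f : Cn n → ℂ} (hf : ContDiff ℝ 1 f)
    (hc : HasCompactSupport f) (v : Cn n) : ∫ z, fderiv ℝ f z v = 0 := by
  have hcont : Continuous fun z => fderiv ℝ f z v :=
    (hf.continuous_fderiv one_ne_zero).clm_apply continuous_const
  have hint : Integrable fun z => fderiv ℝ f z v :=
    hcont.integrable_of_hasCompactSupport (hc.fderiv_apply (𝕜 := ℝ) v)
  have := integral_mul_fderiv_eq_neg_fderiv_mul_of_integrable (𝕜 := ℂ) (μ := volume)
    (f := f) (g := fun _ : Cn n => (1 : ℂ)) (v := v) (by simpa using hint) (by simp)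
    (by simpa using hf.continuous.integrable_of_hasCompactSupport hc)
    (fun x _ => hf.differentiable one_ne_zero x) (fun x _ => by simp)
  simpa using this

theorem integral_wder_eq_zero {n : ℕ} (m : Fin n) {f : Cn n → ℂ} (hf : ContDiff ℝ 1 f)
    (hc : HasCompactSupport f) : ∫ z, wder m f z = 0 := by
  have hint (v : Cn n) : Integrable fun z => fderiv ℝ f z v :=
    ((hf.continuous_fderiv one_ne_zero).clm_apply
      continuous_const).integrable_of_hasCompactSupport (hc.fderiv_apply (𝕜 := ℝ) v)
  unfold wder
  rw [integral_const_mul, integral_sub (hint _) ((hint _).const_mul _), integral_const_mul,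
    integral_fderiv_apply_eq_zero hf hc, integral_fderiv_apply_eq_zero hf hc]
  simp

section Mollification

variable {E F : Type*} [NormedAddCommGroup E] [NormedSpace ℝ E] [FiniteDimensional ℝ E]
  [MeasurableSpace E] [BorelSpace E] (μ : Measure E) [μ.IsAddHaarMeasure]
  [NormedAddCommGroup F] [NormedSpace ℝ F]

open ContinuousLinearMap (lsmul)

theorem integral_norm_normed_convolution_le (ρ : ContDiffBump (0 : E)) {g : E → F}
    (hg : Integrable g μ) :
    ∫ x, ‖(ρ.normed μ ⋆[lsmul ℝ ℝ, μ] g) x‖ ∂μ ≤ ∫ x, ‖g x‖ ∂μ := by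
  have hρ : Integrable (ρ.normed μ) μ := ρ.integrable_normed
  calc ∫ x, ‖(ρ.normed μ ⋆[lsmul ℝ ℝ, μ] g) x‖ ∂μ
      ≤ ∫ x, (ρ.normed μ ⋆[lsmul ℝ ℝ, μ] fun y => ‖g y‖) x ∂μ := by
        refine integral_mono (hρ.integrable_convolution _ hg).norm
          (hρ.integrable_convolution _ hg.norm) fun x => ?_
        refine (norm_integral_le_integral_norm _).trans_eq (integral_congr_ae ?_)
        filter_upwards with t
        simp [norm_smul, abs_of_nonneg (ρ.nonneg_normed t)]
    _ = ∫ x, ‖g x‖ ∂μ := by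
        rw [integral_convolution _ hρ hg.norm, ρ.integral_normed]
        simp

theorem norm_normed_convolution_le (ρ : ContDiffBump (0 : E)) {g : E → F} {C : ℝ}
    (hC : ∀ x, ‖g x‖ ≤ C) (x : E) : ‖(ρ.normed μ ⋆[lsmul ℝ ℝ, μ] g) x‖ ≤ C := by
  calc ‖(ρ.normed μ ⋆[lsmul ℝ ℝ, μ] g) x‖ ≤ ∫ t, ρ.normed μ t * C ∂μ := by
        refine norm_integral_le_of_norm_le (ρ.integrable_normed.mul_const C) ?_
        filter_upwards with t
        simp only [ContinuousLinearMap.lsmul_apply, norm_smul, Real.norm_eq_abs,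
          abs_of_nonneg (ρ.nonneg_normed t)]
        exact mul_le_mul_of_nonneg_left (hC _) (ρ.nonneg_normed t)
    _ = C := by rw [integral_mul_const, ρ.integral_normed, one_mul]

/-- Mollifications of an integrable function converge to it in `L¹` on compact sets. -/
theorem tendsto_setIntegral_norm_normed_convolution_sub [CompleteSpace F]
    {ρ : ℕ → ContDiffBump (0 : E)}
    (hρ : Tendsto (fun k => (ρ k).rOut) atTop (𝓝 0)) {g : E → F} (hg : Integrable g μ)
    {K : Set E} (hK : IsCompact K) :
    Tendsto (fun k => ∫ x in K, ‖((ρ k).normed μ ⋆[lsmul ℝ ℝ, μ] g) x - g x‖ ∂μ)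
      atTop (𝓝 0) := by
  have hnn (k : ℕ) : 0 ≤ ∫ x in K, ‖((ρ k).normed μ ⋆[lsmul ℝ ℝ, μ] g) x - g x‖ ∂μ :=
    integral_nonneg fun _ => norm_nonneg _
  rw [Metric.tendsto_nhds]
  intro η hη
  obtain ⟨c, hc, hgc, hcc, hci⟩ :=
    hg.exists_hasCompactSupport_integral_sub_le (show 0 < η / 3 by positivity)
  obtain ⟨C, hC⟩ := hc.exists_bound_of_continuous hcc
  have hcconv : Tendsto (fun k => ∫ x in K, ‖((ρ k).normed μ ⋆[lsmul ℝ ℝ, μ] c) x - c x‖ ∂μ)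
      atTop (𝓝 0) := by
    have : Tendsto (fun k => ∫ x in K, ‖((ρ k).normed μ ⋆[lsmul ℝ ℝ, μ] c) x - c x‖ ∂μ)
        atTop (𝓝 (∫ _ in K, (0 : ℝ) ∂μ)) := by
      refine tendsto_integral_of_dominated_convergence (fun _ => C + C) (fun k => ?_)
        (integrableOn_const hK.measure_lt_top.ne) (fun k => ?_) ?_
      · exact (((ρ k).integrable_normed.integrable_convolution _ hci).sub
          hci).norm.aestronglyMeasurable.restrict
      · filter_upwards with x
        rw [norm_norm]
        exact (norm_sub_le _ _).trans
          (add_le_add (norm_normed_convolution_le μ (ρ k) hC x) (hC x))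
      · filter_upwards with x
        have := (ContDiffBump.convolution_tendsto_right_of_continuous (μ := μ) hρ hcc x).sub_const
          (c x)
        simpa using this.norm
    simpa using this
  filter_upwards [Metric.tendsto_nhds.1 hcconv (η / 3) (by positivity)] with k hk
  rw [Real.dist_0_eq_abs, abs_of_nonneg (integral_nonneg fun _ => norm_nonneg _)] at hk
  rw [Real.dist_0_eq_abs, abs_of_nonneg (hnn k)]
  have hρi : Integrable ((ρ k).normed μ) μ := (ρ k).integrable_normed
  have hi := hρi.integrable_convolution (lsmul ℝ ℝ) hci
  have hd := hρi.integrable_convolution (lsmul ℝ ℝ) (hg.sub hci)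
  have hd' : IntegrableOn (fun x => ‖((ρ k).normed μ ⋆[lsmul ℝ ℝ, μ] (g - c)) x‖) K μ :=
    hd.norm.integrableOn
  have hgc' : IntegrableOn (fun x => ‖g x - c x‖) K μ := (hg.sub hci).norm.integrableOn
  have hi' : IntegrableOn (fun x => ‖((ρ k).normed μ ⋆[lsmul ℝ ℝ, μ] c) x - c x‖) K μ :=
    (hi.sub hci).norm.integrableOn
  have hadd : IntegrableOn (fun x => ‖((ρ k).normed μ ⋆[lsmul ℝ ℝ, μ] (g - c)) x‖ + ‖g x - c x‖)
      K μ := hd'.add hgc'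
  have hsplit (x : E) : ((ρ k).normed μ ⋆[lsmul ℝ ℝ, μ] g) x =
      ((ρ k).normed μ ⋆[lsmul ℝ ℝ, μ] (g - c)) x + ((ρ k).normed μ ⋆[lsmul ℝ ℝ, μ] c) x := by
    have hex {u : E → F} (hu : Integrable u μ) :
        ConvolutionExistsAt ((ρ k).normed μ) u x (lsmul ℝ ℝ) μ :=
      (ρ k).hasCompactSupport_normed.convolutionExists_left _ (ρ k).continuous_normed
        hu.locallyIntegrable x
    rw [← (hex (hg.sub hci)).distrib_add (hex hci), sub_add_cancel]
  calc ∫ x in K, ‖((ρ k).normed μ ⋆[lsmul ℝ ℝ, μ] g) x - g x‖ ∂μ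
      ≤ ∫ x in K, (‖((ρ k).normed μ ⋆[lsmul ℝ ℝ, μ] (g - c)) x‖ + ‖g x - c x‖
          + ‖((ρ k).normed μ ⋆[lsmul ℝ ℝ, μ] c) x - c x‖) ∂μ := by
        refine integral_mono ((hρi.integrable_convolution _ hg).sub hg).norm.integrableOn
          (hadd.add hi') fun x => ?_
        simp only [hsplit x]
        calc _ = ‖((ρ k).normed μ ⋆[lsmul ℝ ℝ, μ] (g - c)) x - (g x - c x)
                + (((ρ k).normed μ ⋆[lsmul ℝ ℝ, μ] c) x - c x)‖ := by congr 1; abel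
          _ ≤ _ := (norm_add_le _ _).trans (add_le_add_left (norm_sub_le _ _) _)
    _ = ∫ x in K, ‖((ρ k).normed μ ⋆[lsmul ℝ ℝ, μ] (g - c)) x‖ ∂μ + ∫ x in K, ‖g x - c x‖ ∂μ
          + ∫ x in K, ‖((ρ k).normed μ ⋆[lsmul ℝ ℝ, μ] c) x - c x‖ ∂μ := by
        rw [integral_add hadd hi', integral_add hd' hgc']
    _ < η / 3 + η / 3 + η / 3 := by
        refine add_lt_add_of_le_of_lt (add_le_add ?_ ?_) hk
        · exact (setIntegral_le_integral hd.norm (ae_of_all _ fun _ => norm_nonneg _)).trans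
            ((integral_norm_normed_convolution_le μ (ρ k) (hg.sub hci)).trans hgc)
        · exact (setIntegral_le_integral (hg.sub hci).norm
            (ae_of_all _ fun _ => norm_nonneg _)).trans hgc
    _ = η := by ring

end Mollification

theorem fderiv_convolution_apply {n : ℕ} {ρ : Cn n → ℝ} (hρ : ContDiff ℝ 1 ρ)
    (hc : HasCompactSupport ρ) {g : Cn n → ℂ} (hg : LocallyIntegrable g) (z v : Cn n) :
    fderiv ℝ (ρ ⋆[ContinuousLinearMap.lsmul ℝ ℝ, volume] g) z v =
      ∫ y, (fderiv ℝ ρ (z - y) v : ℂ) * g y := by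
  rw [(hc.hasFDerivAt_convolution_left (ContinuousLinearMap.lsmul ℝ ℝ) hρ hg z).fderiv,
    convolution_eq_swap, ContinuousLinearMap.integral_apply]
  · simp [ContinuousLinearMap.precompL_apply]
  · exact ((hc.fderiv (𝕜 := ℝ)).convolutionExists_left _
      (hρ.continuous_fderiv one_ne_zero) hg z).integrable_swap

theorem wder_convolution {n : ℕ} (m : Fin n) {ρ : Cn n → ℝ} (hρ : ContDiff ℝ 1 ρ)
    (hc : HasCompactSupport ρ) {g : Cn n → ℂ} (hg : LocallyIntegrable g) (z : Cn n) :
    wder m (ρ ⋆[ContinuousLinearMap.lsmul ℝ ℝ, volume] g) z =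
      -∫ y, g y * wder m (fun y => (ρ (z - y) : ℂ)) y := by
  have hint (v : Cn n) : Integrable fun y => (fderiv ℝ ρ (z - y) v : ℂ) * g y := by
    have hcont : Continuous fun y => fderiv ℝ ρ y v :=
      (hρ.continuous_fderiv one_ne_zero).clm_apply continuous_const
    simpa using ((hc.fderiv_apply (𝕜 := ℝ) v).convolutionExists_left
      (ContinuousLinearMap.lsmul ℝ ℝ) hcont hg z).integrable_swap
  have hder (y v : Cn n) :
      fderiv ℝ (fun y => (ρ (z - y) : ℂ)) y v = -(fderiv ℝ ρ (z - y) v : ℂ) := by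
    have h1 : HasFDerivAt (fun y => z - y) (-ContinuousLinearMap.id ℝ (Cn n)) y :=
      (hasFDerivAt_id y).const_sub z
    have h2 := (hρ.differentiable one_ne_zero (z - y)).hasFDerivAt.comp y h1
    have h3 := Complex.ofRealCLM.hasFDerivAt.comp y h2
    have h4 : HasFDerivAt (fun y => (ρ (z - y) : ℂ)) _ y := h3
    rw [h4.fderiv]
    simp
  simp only [wder]
  rw [fderiv_convolution_apply hρ hc hg, fderiv_convolution_apply hρ hc hg, ← integral_const_mul,
    ← integral_sub (hint _) ((hint _).const_mul _), ← integral_const_mul, ← integral_neg]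
  refine integral_congr_ae (ae_of_all _ fun y => ?_)
  simp only [hder]
  ring

/-- Mollification commutes with the weak derivative, as long as the mollifier stays inside the
domain. -/
theorem IsWeakWirtDeriv.wder_normed_convolution {n : ℕ} {U K : Set (Cn n)} {m : Fin n}
    {f D : Cn n → ℂ} (hD : IsWeakWirtDeriv U m f D) (hU : IsOpen U) (hK : MeasurableSet K)
    (hKU : K ⊆ U) (hf : IntegrableOn f K) (ρ : ContDiffBump (0 : Cn n)) {z : Cn n}
    (hz : closedBall z ρ.rOut ⊆ K) :
    wder m (ρ.normed volume ⋆[ContinuousLinearMap.lsmul ℝ ℝ, volume] K.indicator f) z =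
      (ρ.normed volume ⋆[ContinuousLinearMap.lsmul ℝ ℝ, volume] K.indicator D) z := by
  set φ : Cn n → ℂ := fun y => (ρ.normed volume (z - y) : ℂ) with hφ
  have hsupp : tsupport φ ⊆ closedBall z ρ.rOut := by
    refine closure_minimal (fun y hy => ?_) isClosed_closedBall
    have : z - y ∈ Function.support (ρ.normed volume) := by
      simpa [hφ] using hy
    rw [ρ.support_normed_eq, mem_ball_zero_iff] at this
    rw [mem_closedBall, dist_comm, dist_eq_norm]
    exact this.le
  have hφK : ∀ y ∉ K, φ y = 0 := fun y hy =>
    image_eq_zero_of_notMem_tsupport fun h => hy (hz (hsupp h))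
  have hφK' : ∀ y ∉ K, wder m φ y = 0 := fun y hy =>
    wder_eq_zero_of_notMem_tsupport m fun h => hy (hz (hsupp h))
  have hφsm : ContDiff ℝ (⊤ : ℕ∞) φ :=
    Complex.ofRealCLM.contDiff.comp (ρ.contDiff_normed.comp (contDiff_const.sub contDiff_id))
  have hφc : HasCompactSupport φ :=
    HasCompactSupport.of_support_subset_isCompact (isCompact_closedBall z ρ.rOut)
      ((subset_tsupport φ).trans hsupp)
  have key := hD φ hφsm hφc (hsupp.trans (hz.trans hKU))
  have hind (u w : Cn n → ℂ) (hw : ∀ y ∉ K, w y = 0) :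
      ∫ y, K.indicator u y * w y = ∫ y in U, u y * w y := by
    rw [← integral_indicator hU.measurableSet]
    refine integral_congr_ae (ae_of_all _ fun y => ?_)
    by_cases hy : y ∈ K
    · simp [hy, hKU hy]
    · by_cases hyU : y ∈ U <;> simp [hy, hyU, hw y hy]
  rw [wder_convolution m ρ.contDiff_normed ρ.hasCompactSupport_normed
    (hf.integrable_indicator hK).locallyIntegrable, hind f _ hφK', key, neg_neg, ← hind D φ hφK,
    convolution_eq_swap]
  refine integral_congr_ae (ae_of_all _ fun y => ?_)
  simp [hφ, mul_comm]

theorem le_re_normed_convolution {n : ℕ} {K : Set (Cn n)} {g : Cn n → ℂ} {ε : ℝ}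
    (hg : LocallyIntegrable g) (hre : ∀ y ∈ K, ε ≤ (g y).re) (ρ : ContDiffBump (0 : Cn n))
    {z : Cn n} (hz : closedBall z ρ.rOut ⊆ K) :
    ε ≤ ((ρ.normed volume ⋆[ContinuousLinearMap.lsmul ℝ ℝ, volume] g) z).re := by
  have hint : Integrable fun t => (ρ.normed volume t : ℝ) • g (z - t) := by
    simpa [ConvolutionExistsAt] using ρ.hasCompactSupport_normed.convolutionExists_left
      (ContinuousLinearMap.lsmul ℝ ℝ) ρ.continuous_normed hg z
  have h1 : ((ρ.normed volume ⋆[ContinuousLinearMap.lsmul ℝ ℝ, volume] g) z).re =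
      ∫ t, ρ.normed volume t * (g (z - t)).re := by
    have := Complex.reCLM.integral_comp_comm hint
    simpa [convolution_def] using this.symm
  calc ε = ∫ t, ρ.normed volume t * ε := by
        rw [integral_mul_const, ρ.integral_normed, one_mul]
    _ ≤ ∫ t, ρ.normed volume t * (g (z - t)).re := by
        refine integral_mono (ρ.integrable_normed.mul_const ε) (by simpa using hint.re) fun t => ?_
        by_cases ht : ρ.normed volume t = 0
        · simp [ht]
        · refine mul_le_mul_of_nonneg_left (hre _ (hz ?_)) (ρ.nonneg_normed t)
          have : t ∈ Function.support (ρ.normed volume) := ht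
          rw [ρ.support_normed_eq, mem_ball_zero_iff] at this
          rw [mem_closedBall, dist_eq_norm]
          simpa using this.le
    _ = _ := h1.symm

/-- Integrated form of `∂(1/g) = -∂g / g²` for smooth `g` without zeros on the support of the test
function. -/
theorem setIntegral_inv_mul_wder {n : ℕ} (m : Fin n) {g φ : Cn n → ℂ} (hg : ContDiff ℝ 1 g)
    (hφ : ContDiff ℝ 1 φ) (hc : HasCompactSupport φ) (hne : ∀ z ∈ tsupport φ, g z ≠ 0) :
    ∫ z in tsupport φ, (g z)⁻¹ * wder m φ z =
      ∫ z in tsupport φ, wder m g z * (φ z / g z ^ 2) := by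
  set ψ : Cn n → ℂ := fun z => φ z * (g z)⁻¹ with hψ
  have hψsupp : tsupport ψ ⊆ tsupport φ := tsupport_mul_subset_left
  have hψc : HasCompactSupport ψ := hc.mul_right
  have hψsm : ContDiff ℝ 1 ψ := by
    rw [contDiff_iff_contDiffAt]
    intro z
    by_cases hz : z ∈ tsupport φ
    · exact hφ.contDiffAt.mul (hg.contDiffAt.inv (hne z hz))
    · refine contDiffAt_const (c := (0 : ℂ)) |>.congr_of_eventuallyEq ?_
      exact notMem_tsupport_iff_eventuallyEq.1 fun h => hz (hψsupp h)
  have hder : ∀ z ∈ tsupport φ,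
      wder m ψ z = (g z)⁻¹ * wder m φ z - wder m g z * (φ z / g z ^ 2) := by
    intro z hz
    have h1 := (hφ.differentiable one_ne_zero z).hasFDerivAt
    have h2 := (hasDerivAt_inv (hne z hz)).comp_hasFDerivAt z
      (hg.differentiable one_ne_zero z).hasFDerivAt
    have h3 : HasFDerivAt ψ _ z := h1.mul h2
    simp only [wder, h3.fderiv]
    simp
    ring
  have hcont1 : ContinuousOn (fun z => (g z)⁻¹ * wder m φ z) (tsupport φ) :=
    (hg.continuous.continuousOn.inv₀ hne).mul (continuous_wder m hφ).continuousOn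
  have hcont2 : ContinuousOn (fun z => wder m g z * (φ z / g z ^ 2)) (tsupport φ) :=
    (continuous_wder m hg).continuousOn.mul (hφ.continuous.continuousOn.div
      (hg.continuous.pow 2).continuousOn fun z hz => pow_ne_zero 2 (hne z hz))
  have hzero : ∫ z in tsupport φ, wder m ψ z = 0 := by
    rw [setIntegral_eq_integral_of_forall_compl_eq_zero fun z hz =>
      wder_eq_zero_of_notMem_tsupport m fun h => hz (hψsupp h), integral_wder_eq_zero m hψsm hψc]
  rw [setIntegral_congr_fun (isClosed_tsupport φ).measurableSet hder,
    integral_sub (hcont1.integrableOn_compact hc) (hcont2.integrableOn_compact hc)] at hzero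
  exact sub_eq_zero.1 hzero

theorem tendsto_setIntegral_mul_of_tendsto_L1 {α : Type*} [MeasurableSpace α] {μ : Measure α}
    {G w : ℕ → α → ℂ} {g w₀ : α → ℂ} {C : ℝ} (hG : ∀ k, Integrable (G k) μ) (hg : Integrable g μ)
    (hw : ∀ k, AEStronglyMeasurable (w k) μ) (hbd : ∀ k, ∀ᵐ x ∂μ, ‖w k x‖ ≤ C)
    (hlim : ∀ᵐ x ∂μ, Tendsto (fun k => w k x) atTop (𝓝 (w₀ x)))
    (hL1 : Tendsto (fun k => ∫ x, ‖G k x - g x‖ ∂μ) atTop (𝓝 0)) :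
    Tendsto (fun k => ∫ x, G k x * w k x ∂μ) atTop (𝓝 (∫ x, g x * w₀ x ∂μ)) := by
  have h1 : Tendsto (fun k => ∫ x, g x * w k x ∂μ) atTop (𝓝 (∫ x, g x * w₀ x ∂μ)) := by
    refine tendsto_integral_of_dominated_convergence (fun x => ‖g x‖ * C)
      (fun k => hg.aestronglyMeasurable.mul (hw k)) (hg.norm.mul_const C) (fun k => ?_) ?_
    · filter_upwards [hbd k] with x hx
      rw [norm_mul]
      gcongr
    · filter_upwards [hlim] with x hx using hx.const_mul _
  have h2 : Tendsto (fun k => ∫ x, (G k x - g x) * w k x ∂μ) atTop (𝓝 0) := by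
    refine squeeze_zero_norm (fun k => ?_) (by simpa using hL1.mul_const C)
    rw [← integral_mul_const]
    refine norm_integral_le_of_norm_le (((hG k).sub hg).norm.mul_const C) ?_
    filter_upwards [hbd k] with x hx
    rw [norm_mul]
    gcongr
  refine (by simpa using h2.add h1 : Tendsto _ _ _).congr fun k => ?_
  have hi1 : Integrable (fun x => (G k x - g x) * w k x) μ :=
    ((hG k).sub hg).mul_bdd (c := C) (hw k) (hbd k)
  have hi2 : Integrable (fun x => g x * w k x) μ := hg.mul_bdd (c := C) (hw k) (hbd k)
  rw [← integral_add hi1 hi2]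
  exact integral_congr_ae (ae_of_all _ fun x => by ring)

/-- The chain rule for the reciprocal of a function in `W^{1,1}_loc` with positive real part bounded
away from zero. -/
theorem IsWeakWirtDeriv.inv_of_integrableOn {n : ℕ} {U : Set (Cn n)} (hU : IsOpen U) {m : Fin n}
    {f D : Cn n → ℂ} (hf : ∀ K, IsCompact K → K ⊆ U → IntegrableOn f K)
    (hDi : ∀ K, IsCompact K → K ⊆ U → IntegrableOn D K) {ε : ℝ} (hε : 0 < ε)
    (hre : ∀ z ∈ U, ε ≤ (f z).re) (hD : IsWeakWirtDeriv U m f D) :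
    IsWeakWirtDeriv U m (fun z => (f z)⁻¹) (fun z => -(D z) / (f z) ^ 2) := by
  intro φ hφ hc hφU
  set K := tsupport φ with hK
  have hKm : MeasurableSet K := (isClosed_tsupport φ).measurableSet
  have hφ1 : ContDiff ℝ 1 φ := hφ.of_le (by exact_mod_cast le_top)
  obtain ⟨δ, hδ, hδU⟩ := hc.isCompact.exists_cthickening_subset_open hU hφU
  set K₁ := cthickening δ K with hK₁
  have hK₁c : IsCompact K₁ := hc.isCompact.cthickening
  have hKK₁ : K ⊆ K₁ := self_subset_cthickening K
  have hfi := (hf K₁ hK₁c hδU).integrable_indicator hK₁c.measurableSet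
  have hDi' := (hDi K₁ hK₁c hδU).integrable_indicator hK₁c.measurableSet
  let ρ (k : ℕ) : ContDiffBump (0 : Cn n) :=
    { rIn := δ / (k + 1) / 2
      rOut := δ / (k + 1)
      rIn_pos := by positivity
      rIn_lt_rOut := half_lt_self (by positivity) }
  have hρ : Tendsto (fun k => (ρ k).rOut) atTop (𝓝 0) := by
    simpa [ρ, div_eq_mul_inv] using (tendsto_one_div_add_atTop_nhds_zero_nat (𝕜 := ℝ)).const_mul δ
  have hball : ∀ k, ∀ z ∈ K, closedBall z (ρ k).rOut ⊆ K₁ := fun k z hz =>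
    (closedBall_subset_closedBall (div_le_self hδ.le (by simp))).trans
      (closedBall_subset_cthickening hz δ)
  set F : ℕ → Cn n → ℂ := fun k => (ρ k).normed volume
    ⋆[ContinuousLinearMap.lsmul ℝ ℝ, volume] K₁.indicator f with hF
  set G : ℕ → Cn n → ℂ := fun k => (ρ k).normed volume
    ⋆[ContinuousLinearMap.lsmul ℝ ℝ, volume] K₁.indicator D with hG
  have hFsm (k : ℕ) : ContDiff ℝ 1 (F k) :=
    (ρ k).hasCompactSupport_normed.contDiff_convolution_left _ (ρ k).contDiff_normed
      hfi.locallyIntegrable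
  have hnorm : ∀ {w : ℂ}, ε ≤ w.re → ε ≤ ‖w‖ := fun h => h.trans (Complex.re_le_norm _)
  have hFε : ∀ k, ∀ z ∈ K, ε ≤ ‖F k z‖ := fun k z hz =>
    hnorm (le_re_normed_convolution hfi.locallyIntegrable
      (fun y hy => by simpa [hy] using hre y (hδU hy)) (ρ k) (hball k z hz))
  have hFne : ∀ k, ∀ z ∈ K, F k z ≠ 0 := fun k z hz =>
    norm_pos_iff.1 (hε.trans_le (hFε k z hz))
  have hfne : ∀ z ∈ K, f z ≠ 0 := fun z hz =>
    norm_pos_iff.1 (hε.trans_le (hnorm (hre z (hφU hz))))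
  have hFlim : ∀ᵐ z ∂volume.restrict K, Tendsto (fun k => F k z) atTop (𝓝 (f z)) := by
    have := ContDiffBump.ae_convolution_tendsto_right_of_locallyIntegrable (μ := volume) (K := 2)
      hρ (Eventually.of_forall fun k => (by simp only [ρ]; linarith)) hfi.locallyIntegrable
    filter_upwards [ae_restrict_of_ae this, ae_restrict_mem hKm] with z hz hzK
    simpa [hKK₁ hzK] using hz
  have hident (k : ℕ) : ∫ z in K, (F k z)⁻¹ * wder m φ z =
      ∫ z in K, G k z * (φ z / F k z ^ 2) := by
    rw [hK, setIntegral_inv_mul_wder m (hFsm k) hφ1 hc (hFne k)]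
    refine setIntegral_congr_fun hKm fun z hz => ?_
    rw [hF, hD.wder_normed_convolution hU hK₁c.measurableSet hδU (hf K₁ hK₁c hδU) (ρ k)
      (hball k z hz)]
  obtain ⟨C, hC⟩ := hc.exists_bound_of_continuous hφ1.continuous
  have hleft : Tendsto (fun k => ∫ z in K, (F k z)⁻¹ * wder m φ z) atTop
      (𝓝 (∫ z in K, (f z)⁻¹ * wder m φ z)) := by
    refine tendsto_integral_of_dominated_convergence (fun z => ε⁻¹ * ‖wder m φ z‖) (fun k => ?_)
      ((integrable_wder m hφ1 hc).norm.const_mul _).integrableOn (fun k => ?_) ?_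
    · exact (((hFsm k).continuous.continuousOn.inv₀ (hFne k)).mul
        (continuous_wder m hφ1).continuousOn).aestronglyMeasurable hKm
    · filter_upwards [ae_restrict_mem hKm] with z hz
      rw [norm_mul, norm_inv]
      gcongr
      exact hFε k z hz
    · filter_upwards [hFlim, ae_restrict_mem hKm] with z hz hzK
      exact (hz.inv₀ (hfne z hzK)).mul_const _
  have hright : Tendsto (fun k => ∫ z in K, G k z * (φ z / F k z ^ 2)) atTop
      (𝓝 (∫ z in K, D z * (φ z / f z ^ 2))) := by
    refine tendsto_setIntegral_mul_of_tendsto_L1 (C := C / ε ^ 2) (fun k => ?_)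
      (hDi K hc.isCompact hφU) (fun k => ?_) (fun k => ?_) ?_ ?_
    · exact ((ρ k).integrable_normed.integrable_convolution _ hDi').integrableOn
    · exact (hφ1.continuous.continuousOn.div ((hFsm k).continuous.pow 2).continuousOn
        fun z hz => pow_ne_zero 2 (hFne k z hz)).aestronglyMeasurable hKm
    · filter_upwards [ae_restrict_mem hKm] with z hz
      rw [norm_div, norm_pow]
      have := (norm_nonneg _).trans (hC z)
      have := hFε k z hz
      gcongr
      exact hC z
    · filter_upwards [hFlim, ae_restrict_mem hKm] with z hz hzK
      exact tendsto_const_nhds.div (hz.pow 2) (pow_ne_zero 2 (hfne z hzK))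
    · refine (tendsto_setIntegral_norm_normed_convolution_sub volume hρ hDi' hc.isCompact).congr
        fun k => setIntegral_congr_fun hKm fun z hz => ?_
      simp [hG, hKK₁ hz]
  have hlim := tendsto_nhds_unique (hleft.congr hident) hright
  have hzero : ∀ z ∈ U \ K, φ z = 0 := fun z hz => image_eq_zero_of_notMem_tsupport hz.2
  rw [setIntegral_eq_of_subset_of_forall_sdiff_eq_zero hU.measurableSet hφU fun z hz => by
      rw [wder_eq_zero_of_notMem_tsupport m hz.2, mul_zero], hlim,
    setIntegral_eq_of_subset_of_forall_sdiff_eq_zero hU.measurableSet hφU fun z hz => by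
      rw [hzero z hz, mul_zero], ← integral_neg]
  exact integral_congr_ae (ae_of_all _ fun z => by ring)

theorem wder_add {n : ℕ} (m : Fin n) {f g : Cn n → ℂ} {z : Cn n} (hf : DifferentiableAt ℝ f z)
    (hg : DifferentiableAt ℝ g z) : wder m (fun z => f z + g z) z = wder m f z + wder m g z := by
  simp only [wder, fderiv_fun_add hf hg, _root_.add_apply]
  ring

/-- A function whose products with all test functions are integrable is integrable on compact
sets. -/
theorem integrableOn_of_forall_integrableOn_mul {n : ℕ} {U : Set (Cn n)} (hU : IsOpen U)
    {D : Cn n → ℂ}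
    (hD : ∀ φ : Cn n → ℂ, ContDiff ℝ (⊤ : ℕ∞) φ → HasCompactSupport φ → tsupport φ ⊆ U →
      IntegrableOn (fun z => D z * φ z) U) {K : Set (Cn n)} (hK : IsCompact K) (hKU : K ⊆ U) :
    IntegrableOn D K := by
  have hloc : LocallyIntegrableOn D U := by
    intro x hx
    obtain ⟨δ, hδ, hδU⟩ := nhds_basis_closedBall.mem_iff.1 (hU.mem_nhds hx)
    let b : ContDiffBump x := ⟨δ / 2, δ, half_pos hδ, half_lt_self hδ⟩
    have hb := hD (fun z => (b z : ℂ)) (Complex.ofRealCLM.contDiff.comp b.contDiff)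
      (b.hasCompactSupport.comp_left Complex.ofReal_zero)
      ((closure_mono (Function.support_comp_subset Complex.ofReal_zero b)).trans
        (b.tsupport_eq.subset.trans hδU))
    refine ⟨closedBall x (δ / 2),
      mem_nhdsWithin_of_mem_nhds (closedBall_mem_nhds x (half_pos hδ)), ?_⟩
    refine (hb.mono_set ((closedBall_subset_closedBall (half_le_self hδ.le)).trans hδU)).congr_fun
      (fun z hz => ?_) isClosed_closedBall.measurableSet
    have : b z = 1 := b.one_of_mem_closedBall hz
    simp [this]
  exact hloc.integrableOn_compact_subset hKU hK

/-- If some product `D * ψ` with a test function is not integrable, then the weak derivative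
identity only holds because `f` has vanishing weak derivative. -/
theorem IsWeakWirtDeriv.zero_of_not_integrableOn {n : ℕ} {U : Set (Cn n)} (hU : IsOpen U)
    {m : Fin n} {f D ψ : Cn n → ℂ} (hf : ∀ K, IsCompact K → K ⊆ U → IntegrableOn f K)
    (hD : IsWeakWirtDeriv U m f D) (hψ : ContDiff ℝ (⊤ : ℕ∞) ψ) (hψc : HasCompactSupport ψ)
    (hψU : tsupport ψ ⊆ U) (hψi : ¬ IntegrableOn (fun z => D z * ψ z) U) :
    IsWeakWirtDeriv U m f (fun _ => 0) := by
  intro φ hφ hc hφU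
  simp only [zero_mul, integral_zero, neg_zero]
  by_cases hi : IntegrableOn (fun z => D z * φ z) U
  swap
  · rw [hD φ hφ hc hφU, integral_undef hi, neg_zero]
  have hint : ∀ {χ : Cn n → ℂ}, ContDiff ℝ (⊤ : ℕ∞) χ → HasCompactSupport χ → tsupport χ ⊆ U →
      IntegrableOn (fun z => f z * wder m χ z) U := fun {χ} h1 h2 h3 =>
    ((hf _ h2.isCompact h3).mul_continuousOn
      (continuous_wder m (h1.of_le (by exact_mod_cast le_top))).continuousOn
      h2.isCompact).of_forall_sdiff_eq_zero
      hU.measurableSet fun z hz => by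
        rw [wder_eq_zero_of_notMem_tsupport m hz.2, mul_zero]
  have hsumU : tsupport (fun z => φ z + ψ z) ⊆ U :=
    (tsupport_add φ ψ).trans (Set.union_subset hφU hψU)
  have hsum := hD (fun z => φ z + ψ z) (hφ.add hψ) (hc.add hψc) hsumU
  have hsumi : ¬ IntegrableOn (fun z => D z * (φ z + ψ z)) U := fun h => hψi <| by
    refine (h.sub hi).congr (ae_of_all _ fun z => ?_)
    simp only [Pi.sub_apply]
    ring
  have hψ0 := hD ψ hψ hψc hψU
  rw [integral_undef hψi, neg_zero] at hψ0
  rw [integral_undef hsumi, neg_zero] at hsum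
  have hsplit : ∀ z, f z * wder m (fun z => φ z + ψ z) z = f z * wder m φ z + f z * wder m ψ z :=
    fun z => by
      rw [wder_add m (hφ.differentiable (by simp) z) (hψ.differentiable (by simp) z), mul_add]
  simp_rw [hsplit] at hsum
  rwa [integral_add (hint hφ hc hφU) (hint hψ hψc hψU), hψ0, add_zero] at hsum

theorem IsWeakWirtDeriv.ae_mul_eq_zero {n : ℕ} {U : Set (Cn n)} (hU : IsOpen U) {m : Fin n}
    {f D φ : Cn n → ℂ} (hD : IsWeakWirtDeriv U m f D)
    (hD0 : IsWeakWirtDeriv U m f (fun _ => 0)) (hφ : ContDiff ℝ (⊤ : ℕ∞) φ)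
    (hc : HasCompactSupport φ) (hφU : tsupport φ ⊆ U)
    (hi : IntegrableOn (fun z => D z * φ z) U) : ∀ᵐ z, z ∈ U → D z * φ z = 0 := by
  refine hU.ae_eq_zero_of_integral_contDiff_smul_eq_zero hi.locallyIntegrableOn
    fun g hg hgc hgU => ?_
  have hχ : ContDiff ℝ (⊤ : ℕ∞) fun z => (g z : ℂ) * φ z :=
    (Complex.ofRealCLM.contDiff.comp hg).mul hφ
  have hχc : HasCompactSupport fun z => (g z : ℂ) * φ z := hc.mul_left
  have hχU : tsupport (fun z => (g z : ℂ) * φ z) ⊆ U := tsupport_mul_subset_right.trans hφU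
  have h1 := hD _ hχ hχc hχU
  rw [hD0 _ hχ hχc hχU] at h1
  simp only [zero_mul, integral_zero, neg_zero, zero_eq_neg] at h1
  rw [setIntegral_eq_integral_of_forall_compl_eq_zero fun z hz => by
    rw [image_eq_zero_of_notMem_tsupport fun h => hz (hφU h), mul_zero, mul_zero]] at h1
  rw [← h1]
  refine integral_congr_ae (ae_of_all _ fun z => ?_)
  simp only [Complex.real_smul]
  ring

/-- The chain rule for the reciprocal of a locally bounded function, without any integrability
assumption on its weak derivative. -/
theorem IsWeakWirtDeriv.inv {n : ℕ} {U : Set (Cn n)} (hU : IsOpen U) {m : Fin n}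
    {f D : Cn n → ℂ} (hfm : Measurable f)
    (hbd : ∀ K, IsCompact K → K ⊆ U → ∃ M : ℝ, ∀ z ∈ K, ‖f z‖ ≤ M) {ε : ℝ} (hε : 0 < ε)
    (hre : ∀ z ∈ U, ε ≤ (f z).re) (hD : IsWeakWirtDeriv U m f D) :
    IsWeakWirtDeriv U m (fun z => (f z)⁻¹) (fun z => -(D z) / (f z) ^ 2) := by
  have hf : ∀ K, IsCompact K → K ⊆ U → IntegrableOn f K := fun K hK hKU => by
    obtain ⟨M, hM⟩ := hbd K hK hKU
    exact IntegrableOn.of_bound hK.measure_lt_top hfm.aestronglyMeasurable M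
      ((ae_restrict_mem hK.measurableSet).mono hM)
  by_cases hall : ∀ φ : Cn n → ℂ, ContDiff ℝ (⊤ : ℕ∞) φ → HasCompactSupport φ → tsupport φ ⊆ U →
      IntegrableOn (fun z => D z * φ z) U
  · exact hD.inv_of_integrableOn hU hf
      (fun K hK hKU => integrableOn_of_forall_integrableOn_mul hU hall hK hKU) hε hre
  push Not at hall
  obtain ⟨ψ, hψ, hψc, hψU, hψi⟩ := hall
  have hD0 := hD.zero_of_not_integrableOn hU hf hψ hψc hψU hψi
  intro φ hφ hc hφU
  have h0 := hD0.inv_of_integrableOn hU hf (fun K _ _ => integrableOn_zero) hε hre φ hφ hc hφU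
  simp only [neg_zero, zero_div, zero_mul, integral_zero] at h0
  rw [h0, zero_eq_neg]
  have hne : ∀ z ∈ U, f z ≠ 0 := fun z hz h => by
    have := hre z hz
    rw [h, Complex.zero_re] at this
    linarith
  by_cases hi : IntegrableOn (fun z => D z * φ z) U
  · refine integral_eq_zero_of_ae ?_
    filter_upwards [ae_restrict_of_ae (hD.ae_mul_eq_zero hU hD0 hφ hc hφU hi),
      ae_restrict_mem hU.measurableSet] with z hz hzU
    have := hz hzU
    simp only [Pi.zero_apply]
    rw [div_mul_eq_mul_div, neg_mul, this, neg_zero, zero_div]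
  · refine integral_undef fun h => hi ?_
    obtain ⟨M, hM⟩ := hbd _ hc.isCompact hφU
    have hK : IntegrableOn (fun z => -(f z) ^ 2 * (-(D z) / f z ^ 2 * φ z)) (tsupport φ) := by
      refine (IntegrableOn.mono_set h hφU).bdd_mul (c := M ^ 2)
        (hfm.pow_const 2).neg.aestronglyMeasurable ?_
      filter_upwards [ae_restrict_mem (isClosed_tsupport φ).measurableSet] with z hz
      rw [norm_neg, norm_pow]
      have := hM z hz
      gcongr
    refine (hK.congr_fun (fun z hz => ?_)
      (isClosed_tsupport φ).measurableSet).of_forall_sdiff_eq_zero hU.measurableSet fun z hz => ?_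
    · have := hne z (hφU hz)
      field_simp
    · rw [image_eq_zero_of_notMem_tsupport hz.2, mul_zero]

theorem Matrix.PosSemidef.norm_det_le_trace_pow {r : ℕ} {A : Matrix (Fin r) (Fin r) ℂ}
    (hA : A.PosSemidef) : ‖A.det‖ ≤ A.trace.re ^ r := by
  have htr : A.trace.re = ∑ i, hA.isHermitian.eigenvalues i := by
    rw [hA.isHermitian.trace_eq_sum_eigenvalues]
    simp
  rw [hA.isHermitian.det_eq_prod_eigenvalues, norm_prod, htr]
  calc _ ≤ ∏ _i : Fin r, ∑ i, hA.isHermitian.eigenvalues i := by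
        refine Finset.prod_le_prod (fun _ _ => norm_nonneg _) fun i _ => ?_
        refine (RCLike.norm_of_nonneg (hA.eigenvalues_nonneg i)).trans_le ?_
        exact Finset.single_le_sum (f := hA.isHermitian.eigenvalues)
          (fun j _ => hA.eigenvalues_nonneg j) (Finset.mem_univ i)
    _ = _ := by simp

theorem isOpen_polydisk {n : ℕ} (R : Fin n → ℝ) : IsOpen (Polydisk R) := by
  have : Polydisk R = ⋂ j, {z : Cn n | ‖z j‖ < R j} := by
    ext z
    simp [Polydisk]
  rw [this]
  exact isOpen_iInter_of_finite fun j => isOpen_lt (by fun_prop) continuous_const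

/-- The diagonal entries of a Griffiths semi-negative metric are locally bounded above. -/
theorem GriffithsSemiNegOn.exists_diag_re_le {n r : ℕ} {U : Set (Cn n)} (hU : IsOpen U)
    {h : Cn n → Matrix (Fin r) (Fin r) ℂ} (hneg : GriffithsSemiNegOn U h) {K : Set (Cn n)}
    (hK : IsCompact K) (hKU : K ⊆ U) (a : Fin r) : ∃ M : ℝ, ∀ z ∈ K, (h z a a).re ≤ M := by
  rcases K.eq_empty_or_nonempty with rfl | hne
  · exact ⟨0, by simp⟩
  have hpsh := (hneg U hU subset_rfl (fun _ => Pi.single a 1)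
    fun b => differentiableOn_const _).1
  obtain ⟨z₀, -, hz₀⟩ := (hpsh.mono hKU).exists_isMaxOn hne hK
  refine ⟨(h z₀ a a).re, fun z hz => ?_⟩
  have := hz₀ hz
  simpa [sqNorm, ← Pi.single_star] using this

theorem exists_norm_det_le {n r : ℕ} {U : Set (Cn n)} (hU : IsOpen U)
    {h : Cn n → Matrix (Fin r) (Fin r) ℂ} (hpos : ∀ z ∈ U, (h z).PosSemidef)
    (hneg : GriffithsSemiNegOn U h) {K : Set (Cn n)} (hK : IsCompact K) (hKU : K ⊆ U) :
    ∃ M : ℝ, ∀ z ∈ K, ‖(h z).det‖ ≤ M := by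
  choose M hM using hneg.exists_diag_re_le hU hK hKU
  refine ⟨(∑ a, M a) ^ r, fun z hz => ?_⟩
  have hA := hpos z (hKU hz)
  refine hA.norm_det_le_trace_pow.trans (pow_le_pow_left₀ ?_ ?_ r)
  · exact (Complex.le_def.1 hA.trace_nonneg).1
  · rw [Matrix.trace, Complex.re_sum]
    exact Finset.sum_le_sum fun a _ => hM a z hz

/-- if `h` is a Griffiths semi-negative singular Hermitian metric on a trivial
bundle over a polydisk with `det h > ε > 0`, then `∂(1/det h) = -(∂ det h)/(det h)²`
in the sense of distributions. -/
theorem statement7 {n r : ℕ} (R : Fin n → ℝ) (hR : ∀ j, 0 < R j)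
    (h : Cn n → Matrix (Fin r) (Fin r) ℂ)
    (hsing : IsSingularMetricOn (Polydisk R) h)
    (hneg : GriffithsSemiNegOn (Polydisk R) h)
    (ε : ℝ) (hε : 0 < ε) (hdet : ∀ z ∈ Polydisk R, ε < ((h z).det).re)
    (m : Fin n) (D : Cn n → ℂ)
    (hD : IsWeakWirtDeriv (Polydisk R) m (fun z => (h z).det) D) :
    IsWeakWirtDeriv (Polydisk R) m (fun z => ((h z).det)⁻¹)
      (fun z => -(D z) / ((h z).det) ^ 2) := by
  have hU := isOpen_polydisk R
  have hmeas : Measurable fun z => (h z).det := by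
    simp only [Matrix.det_apply]
    exact Finset.measurable_sum _ fun σ _ =>
      (Finset.measurable_prod _ fun i _ => hsing.1 _ _).const_smul _
  exact hD.inv hU hmeas (fun K hK hKU => exists_norm_det_le hU hsing.2.1 hneg hK hKU) hε
    fun z hz => (hdet z hz).le
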